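/- Limited Gang FJP schedulers are predictable on identical multiprocessor platforms: for every ordered job set J with execution times e_i ∈ [e_i⁻, e_i⁺] and every i ≥ 1 such that J⁺⁽ⁱ⁾ is schedulable by the Limited Gang FJP scheduler, S(J⁻⁽ⁱ⁾) ≤ S(J⁽ⁱ⁾) ≤ S(J⁺⁽ⁱ⁾) and F(J⁻⁽ⁱ⁾) ≤ F(J⁽ⁱ⁾) ≤ F(J⁺⁽ⁱ⁾). -/

import Mathlib

/-- A parallel rigid job `J = (r, v, e, d)`: release time `r`, required number of
processors `v`, execution requirement `e`, absolute deadline `d`. -/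
structure Job where
  r : ℕ
  v : ℕ
  e : ℕ
  d : ℕ

/-- Number of currently free processors in a one-instant processor assignment
(`0` denotes an idle processor). -/
def freeCount {m : ℕ} (σt : Fin m → ℕ) : ℕ :=
  (Finset.univ.filter fun k => σt k = 0).card

/-- Assign the job with identifier `id` to the first `v` free processors. -/
def assignJob {m : ℕ} (σt : Fin m → ℕ) (id v : ℕ) : Fin m → ℕ := fun k =>
  if σt k = 0 ∧ (Finset.univ.filter fun k' => σt k' = 0 ∧ k' < k).card < v then id
  else σt k

/-- One scheduling pass of the (limited or not) Gang scheduler over the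
priority-ordered list of active jobs, given as pairs `(id, v)`: the
highest-priority active job is placed on the first `v` available processors if at
least `v` are available; otherwise it is skipped and the same rule is applied to
the remaining jobs (non-limited variant, `limited = false`), or the pass stops at
this first job that cannot be scheduled (limited variant, `limited = true`). -/
def gangPass (m : ℕ) (limited : Bool) : List (ℕ × ℕ) → (Fin m → ℕ) → (Fin m → ℕ)
  | [], σt => σt
  | (id, v) :: rest, σt =>
    if v ≤ freeCount σt then gangPass m limited rest (assignJob σt id v)
    else if limited then σt
    else gangPass m limited rest σt

/-- The priority-ordered list `(i+1, vᵢ)` of jobs among the `p` highest-priority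
jobs of `J` that are active at time `t` (released, remaining work not exhausted). -/
def activeJobs (J : ℕ → Job) (p t : ℕ) (rem : ℕ → ℕ) : List (ℕ × ℕ) :=
  ((List.range p).filter fun i => decide ((J i).r ≤ t ∧ rem i ≠ 0)).map fun i =>
    (i + 1, (J i).v)

/-- Remaining execution requirement of job `i` at the start of slot `t` in the
Gang FJP schedule of the `p` highest-priority jobs `J⁽ᵖ⁾ = {J₀, …, J_{p-1}}` on
`m` identical processors (`J₀ > J₁ > ⋯` is the decreasing priority order). -/
def remWork (m : ℕ) (J : ℕ → Job) (limited : Bool) (p : ℕ) : ℕ → ℕ → ℕ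
  | 0, i => (J i).e
  | t + 1, i =>
    let σt := gangPass m limited (activeJobs J p t (remWork m J limited p t)) fun _ => 0
    if ∃ k : Fin m, σt k = i + 1 then remWork m J limited p t i - 1
    else remWork m J limited p t i

/-- The schedule `σ(t)`: `schedAt m J limited p t k = i + 1` iff job `Jᵢ` occupies
processor `π_k` at time `t`, and `= 0` iff `π_k` is idle. -/
def schedAt (m : ℕ) (J : ℕ → Job) (limited : Bool) (p t : ℕ) : Fin m → ℕ :=
  gangPass m limited (activeJobs J p t (remWork m J limited p t)) fun _ => 0

/-- `S(J⁽ᵖ⁾)` for `p = i+1`: the time at which job `Jᵢ` begins its execution in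
the schedule of the `p` highest-priority jobs. -/
noncomputable def startTime (m : ℕ) (J : ℕ → Job) (limited : Bool) (p i : ℕ) : ℕ :=
  sInf {t | ∃ k : Fin m, schedAt m J limited p t k = i + 1}

/-- `F(J⁽ᵖ⁾)` for `p = i+1`: the time at which job `Jᵢ` completes its execution in
the schedule of the `p` highest-priority jobs. -/
noncomputable def finishTime (m : ℕ) (J : ℕ → Job) (limited : Bool) (p i : ℕ) : ℕ :=
  sInf {t | remWork m J limited p t i = 0}

/-- The set of the `p` highest-priority jobs of `J` is schedulable if each of these
jobs completes by its deadline. -/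
def Schedulable (m : ℕ) (J : ℕ → Job) (limited : Bool) (p : ℕ) : Prop :=
  ∀ i < p, remWork m J limited p ((J i).d) i = 0

/-- `#A(J⁽ᵖ⁾,t)`: the number of available processors at time `t` in the schedule
of the `p` highest-priority jobs of `J`. -/
def availCount (m : ℕ) (J : ℕ → Job) (limited : Bool) (p t : ℕ) : ℕ :=
  (Finset.univ.filter fun k : Fin m => schedAt m J limited p t k = 0).card


/-- Among the elements of a finite set `s` of a linear order, exactly `min v #s` have fewer
than `v` predecessors in `s`. -/
theorem Finset.card_filter_card_lt {α : Type*} [LinearOrder α] (s : Finset α) (v : ℕ) :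
    (s.filter fun k => (s.filter (· < k)).card < v).card = min v s.card := by
  induction s using Finset.induction_on_max with
  | empty => simp
  | insert a s ha ih =>
    have has : a ∉ s := fun h => lt_irrefl _ (ha a h)
    have hrank : ∀ k ∈ s, (insert a s).filter (· < k) = s.filter (· < k) := fun k hk => by
      rw [Finset.filter_insert, if_neg (ha k hk).not_gt]
    have hranka : (insert a s).filter (· < a) = s := by
      rw [Finset.filter_insert, if_neg (lt_irrefl a), Finset.filter_true_of_mem ha]
    have hs : (s.filter fun k => ((insert a s).filter (· < k)).card < v) =
        s.filter fun k => (s.filter (· < k)).card < v :=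
      Finset.filter_congr fun k hk => by rw [hrank k hk]
    rw [Finset.filter_insert, hranka, hs, Finset.card_insert_of_notMem has]
    split_ifs with h
    · rw [Finset.card_insert_of_notMem (fun h' => has (Finset.mem_filter.1 h').1), ih]
      omega
    · rw [ih]
      omega

section Pass

variable {m : ℕ}

theorem card_firstFree (σ : Fin m → ℕ) (v : ℕ) :
    (Finset.univ.filter fun k =>
      σ k = 0 ∧ (Finset.univ.filter fun k' => σ k' = 0 ∧ k' < k).card < v).card =
      min v (freeCount σ) := by
  have h := Finset.card_filter_card_lt (Finset.univ.filter fun k => σ k = 0) v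
  simpa only [Finset.filter_filter, freeCount] using h

theorem freeCount_assignJob (σ : Fin m → ℕ) {id : ℕ} (hid : id ≠ 0) (v : ℕ) :
    freeCount (assignJob σ id v) = freeCount σ - v := by
  have hset : (Finset.univ.filter fun k => assignJob σ id v k = 0) =
      (Finset.univ.filter fun k => σ k = 0) \ (Finset.univ.filter fun k =>
        σ k = 0 ∧ (Finset.univ.filter fun k' => σ k' = 0 ∧ k' < k).card < v) := by
    ext k
    simp only [Finset.mem_filter, Finset.mem_univ, true_and, Finset.mem_sdiff]
    unfold assignJob
    by_cases h : σ k = 0 ∧ (Finset.univ.filter fun k' => σ k' = 0 ∧ k' < k).card < v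
    · simp [h, hid]
    · simp only [h, if_false, not_false_eq_true, and_true]
  have hsub : (Finset.univ.filter fun k =>
      σ k = 0 ∧ (Finset.univ.filter fun k' => σ k' = 0 ∧ k' < k).card < v) ⊆
      (Finset.univ.filter fun k => σ k = 0) :=
    Finset.monotone_filter_right _ fun _ _ h => h.1
  rw [freeCount, hset, Finset.card_sdiff_of_subset hsub, card_firstFree]
  change freeCount σ - _ = _
  omega

theorem exists_assignJob_eq (σ : Fin m → ℕ) (id : ℕ) {v : ℕ} (hv : 1 ≤ v)
    (hfree : v ≤ freeCount σ) : ∃ k, assignJob σ id v k = id := by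
  have hpos := card_firstFree σ v
  rw [min_eq_left hfree] at hpos
  obtain ⟨k, hk⟩ := Finset.card_pos.1 (by rw [hpos]; exact hv)
  exact ⟨k, if_pos (Finset.mem_filter.1 hk).2⟩

theorem assignJob_eq_or (σ : Fin m → ℕ) (id v : ℕ) (k : Fin m) :
    assignJob σ id v k = id ∨ assignJob σ id v k = σ k := by
  unfold assignJob
  split_ifs <;> simp

theorem assignJob_of_ne_zero {σ : Fin m → ℕ} {k : Fin m} (hk : σ k ≠ 0) (id v : ℕ) :
    assignJob σ id v k = σ k :=
  if_neg fun h => hk h.1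

theorem gangPass_of_ne_zero (limited : Bool) (l : List (ℕ × ℕ)) {σ : Fin m → ℕ} {k : Fin m}
    (hk : σ k ≠ 0) : gangPass m limited l σ k = σ k := by
  induction l generalizing σ with
  | nil => rfl
  | cons a l ih =>
    obtain ⟨id, v⟩ := a
    have hassign := assignJob_of_ne_zero hk id v
    unfold gangPass
    split_ifs
    · rw [ih (hassign.trans_ne hk), hassign]
    · rfl
    · exact ih hk

theorem gangPass_eq_or_mem (limited : Bool) (l : List (ℕ × ℕ)) (σ : Fin m → ℕ) (k : Fin m) :
    gangPass m limited l σ k = σ k ∨ gangPass m limited l σ k ∈ l.map Prod.fst := by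
  induction l generalizing σ with
  | nil => exact Or.inl rfl
  | cons a l ih =>
    obtain ⟨id, v⟩ := a
    unfold gangPass
    split_ifs
    · rcases ih (assignJob σ id v) with h | h
      · rcases assignJob_eq_or σ id v k with h' | h' <;> simp [h, h']
      · exact Or.inr (List.mem_cons_of_mem _ h)
    · exact Or.inl rfl
    · exact (ih σ).imp_right (List.mem_cons_of_mem _)

/-- In the limited pass, removing active jobs and freeing processors never prevents a remaining
job from being scheduled. -/
theorem exists_gangPass_eq_of_sublist {l l' : List (ℕ × ℕ)} (hl : l.Sublist l')
    (hnodup : (l'.map Prod.fst).Nodup) (hpos : ∀ a ∈ l', a.1 ≠ 0 ∧ 1 ≤ a.2)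
    {σ σ' : Fin m → ℕ} (hfree : freeCount σ' ≤ freeCount σ) {id : ℕ}
    (hid : id ∈ l.map Prod.fst) (hid' : ∀ k, σ' k ≠ id)
    (h : ∃ k, gangPass m true l' σ' k = id) : ∃ k, gangPass m true l σ k = id := by
  induction hl generalizing σ σ' with
  | slnil => simp at hid
  | @cons l l' a hl ih =>
    obtain ⟨j, v⟩ := a
    obtain ⟨k, hk⟩ := h
    simp only [List.map_cons, List.nodup_cons] at hnodup
    obtain ⟨hj, hnodup⟩ := hnodup
    have hne : j ≠ id := fun e => hj (e ▸ (hl.map Prod.fst).subset hid)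
    have hj0 := (hpos _ List.mem_cons_self).1
    unfold gangPass at hk
    split_ifs at hk with hfit htrue
    · refine ih hnodup (fun a ha => hpos a (List.mem_cons_of_mem _ ha)) ?_ hid ?_ ⟨k, hk⟩
      · rw [freeCount_assignJob σ' hj0]
        omega
      · intro k
        rcases assignJob_eq_or σ' j v k with h | h <;> rw [h]
        exacts [hne, hid' k]
    · exact absurd hk (hid' k)
    · exact absurd rfl htrue
  | @cons_cons l l' a hl ih =>
    obtain ⟨j, v⟩ := a
    obtain ⟨k, hk⟩ := h
    simp only [List.map_cons, List.nodup_cons] at hnodup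
    obtain ⟨hj, hnodup⟩ := hnodup
    obtain ⟨hj0, hv⟩ : j ≠ 0 ∧ 1 ≤ v := hpos _ List.mem_cons_self
    unfold gangPass at hk ⊢
    split_ifs at hk with hfit htrue
    · rw [if_pos (hfit.trans hfree)]
      by_cases hne : j = id
      · subst hne
        obtain ⟨k, hk⟩ := exists_assignJob_eq σ j hv (hfit.trans hfree)
        exact ⟨k, by rw [gangPass_of_ne_zero true l (hk.trans_ne hj0), hk]⟩
      · refine ih hnodup (fun a ha => hpos a (List.mem_cons_of_mem _ ha)) ?_ ?_ ?_ ⟨k, hk⟩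
        · rw [freeCount_assignJob σ' hj0, freeCount_assignJob σ hj0]
          omega
        · exact (List.mem_cons.1 hid).resolve_left fun e => hne e.symm
        · intro k
          rcases assignJob_eq_or σ' j v k with h | h <;> rw [h]
          exacts [hne, hid' k]
    · exact absurd hk (hid' k)
    · exact absurd rfl htrue

end Pass

theorem succ_mem_activeJobs {J : ℕ → Job} {p t : ℕ} {rem : ℕ → ℕ} {i : ℕ} :
    i + 1 ∈ (activeJobs J p t rem).map Prod.fst ↔ i < p ∧ (J i).r ≤ t ∧ rem i ≠ 0 := by
  simp [activeJobs]

theorem nodup_activeJobs (J : ℕ → Job) (p t : ℕ) (rem : ℕ → ℕ) :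
    ((activeJobs J p t rem).map Prod.fst).Nodup := by
  rw [activeJobs, List.map_map]
  exact (List.nodup_range.filter _).map fun a b h => Nat.succ_injective h

theorem activeJobs_sublist {J J' : ℕ → Job} (hr : ∀ i, (J i).r = (J' i).r)
    (hv : ∀ i, (J i).v = (J' i).v) {rem rem' : ℕ → ℕ} (hrem : ∀ i, rem i ≤ rem' i) (p t : ℕ) :
    (activeJobs J p t rem).Sublist (activeJobs J' p t rem') := by
  simp only [activeJobs, hr, hv]
  refine (List.monotone_filter_right _ fun i hi => ?_).map _
  have := hrem i
  simp only [decide_eq_true_eq] at hi ⊢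
  omega

theorem active_of_schedAt {m : ℕ} {J : ℕ → Job} {limited : Bool} {p t i : ℕ}
    (h : ∃ k, schedAt m J limited p t k = i + 1) :
    i < p ∧ (J i).r ≤ t ∧ remWork m J limited p t i ≠ 0 := by
  obtain ⟨k, hk⟩ := h
  rcases gangPass_eq_or_mem limited (activeJobs J p t (remWork m J limited p t)) (fun _ => 0) k
    with h | h
  · exact absurd (hk.symm.trans h) i.succ_ne_zero
  · exact succ_mem_activeJobs.1 (hk ▸ h)

theorem remWork_succ_of_schedAt {m : ℕ} {J : ℕ → Job} {limited : Bool} {p t i : ℕ}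
    (h : ∃ k, schedAt m J limited p t k = i + 1) :
    remWork m J limited p (t + 1) i = remWork m J limited p t i - 1 :=
  if_pos h

theorem remWork_succ_of_not_schedAt {m : ℕ} {J : ℕ → Job} {limited : Bool} {p t i : ℕ}
    (h : ¬∃ k, schedAt m J limited p t k = i + 1) :
    remWork m J limited p (t + 1) i = remWork m J limited p t i :=
  if_neg h

theorem exists_schedAt_of_remWork_eq_zero {m : ℕ} {J : ℕ → Job} {limited : Bool} {p t i : ℕ}
    (he : (J i).e ≠ 0) (h : remWork m J limited p t i = 0) :
    ∃ s < t, ∃ k, schedAt m J limited p s k = i + 1 := by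
  by_contra! hno
  have hconst : ∀ s ≤ t, remWork m J limited p s i = (J i).e := by
    intro s hs
    induction s with
    | zero => rfl
    | succ s ih =>
      rw [remWork_succ_of_not_schedAt (by simpa using hno s hs), ih (by omega)]
  exact he ((hconst t le_rfl).symm.trans h)

theorem schedAt_of_remWork_le {m : ℕ} {J J' : ℕ → Job} (hr : ∀ i, (J i).r = (J' i).r)
    (hv : ∀ i, (J i).v = (J' i).v) (hv1 : ∀ i, 1 ≤ (J' i).v) {p t i : ℕ}
    (hrem : ∀ i, remWork m J true p t i ≤ remWork m J' true p t i)
    (hi : remWork m J true p t i ≠ 0) (h : ∃ k, schedAt m J' true p t k = i + 1) :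
    ∃ k, schedAt m J true p t k = i + 1 := by
  obtain ⟨hip, hri, -⟩ := active_of_schedAt h
  refine exists_gangPass_eq_of_sublist (activeJobs_sublist hr hv hrem p t)
    (nodup_activeJobs _ _ _ _) ?_ le_rfl (succ_mem_activeJobs.2 ⟨hip, hr i ▸ hri, hi⟩)
    (fun _ => i.succ_ne_zero.symm) h
  intro a ha
  obtain ⟨j, -, rfl⟩ := List.mem_map.1 ha
  exact ⟨j.succ_ne_zero, hv1 j⟩

theorem remWork_mono {m : ℕ} {J J' : ℕ → Job} (hr : ∀ i, (J i).r = (J' i).r)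
    (hv : ∀ i, (J i).v = (J' i).v) (hv1 : ∀ i, 1 ≤ (J' i).v) (he : ∀ i, (J i).e ≤ (J' i).e)
    (p t i : ℕ) : remWork m J true p t i ≤ remWork m J' true p t i := by
  induction t generalizing i with
  | zero => exact he i
  | succ t ih =>
    have hti := ih i
    by_cases h' : ∃ k, schedAt m J' true p t k = i + 1
    · rw [remWork_succ_of_schedAt h']
      by_cases h : ∃ k, schedAt m J true p t k = i + 1
      · rw [remWork_succ_of_schedAt h]
        omega
      · have h0 : remWork m J true p t i = 0 := by
          by_contra h0
          exact h (schedAt_of_remWork_le hr hv hv1 ih h0 h')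
        rw [remWork_succ_of_not_schedAt h, h0]
        exact Nat.zero_le _
    · rw [remWork_succ_of_not_schedAt h']
      by_cases h : ∃ k, schedAt m J true p t k = i + 1
      · rw [remWork_succ_of_schedAt h]
        omega
      · rwa [remWork_succ_of_not_schedAt h]

theorem finishTime_mono {m : ℕ} {J J' : ℕ → Job} (hr : ∀ i, (J i).r = (J' i).r)
    (hv : ∀ i, (J i).v = (J' i).v) (hv1 : ∀ i, 1 ≤ (J' i).v) (he : ∀ i, (J i).e ≤ (J' i).e)
    {p i t : ℕ} (hfin : remWork m J' true p t i = 0) :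
    finishTime m J true p i ≤ finishTime m J' true p i := by
  have hmem : remWork m J' true p (finishTime m J' true p i) i = 0 :=
    Nat.sInf_mem (s := {t | remWork m J' true p t i = 0}) ⟨t, hfin⟩
  exact Nat.sInf_le (Nat.le_zero.1 (hmem ▸ remWork_mono hr hv hv1 he p _ i))

theorem startTime_mono {m : ℕ} {J J' : ℕ → Job} (hr : ∀ i, (J i).r = (J' i).r)
    (hv : ∀ i, (J i).v = (J' i).v) (hv1 : ∀ i, 1 ≤ (J' i).v) (he : ∀ i, (J i).e ≤ (J' i).e)
    {p i t : ℕ} (hfin : remWork m J' true p t i = 0) :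
    startTime m J true p i ≤ startTime m J' true p i := by
  by_cases he0 : (J i).e = 0
  · have hempty : {t | ∃ k : Fin m, schedAt m J true p t k = i + 1} = ∅ := by
      refine Set.eq_empty_of_forall_notMem fun s hs => (active_of_schedAt hs).2.2 ?_
      clear hs
      induction s with
      | zero => exact he0
      | succ s ih =>
        rw [remWork_succ_of_not_schedAt fun h => (active_of_schedAt h).2.2 ih, ih]
    rw [startTime, hempty, Nat.sInf_empty]
    exact Nat.zero_le _
  · obtain ⟨s, -, hs⟩ := exists_schedAt_of_remWork_eq_zero (by have := he i; omega) hfin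
    have hmem : ∃ k : Fin m, schedAt m J' true p (startTime m J' true p i) k = i + 1 :=
      Nat.sInf_mem (s := {t | ∃ k : Fin m, schedAt m J' true p t k = i + 1}) ⟨s, hs⟩
    by_cases h0 : remWork m J true p (startTime m J' true p i) i = 0
    · obtain ⟨u, hu, hsched⟩ := exists_schedAt_of_remWork_eq_zero he0 h0
      exact (Nat.sInf_le hsched).trans hu.le
    · exact Nat.sInf_le
        (schedAt_of_remWork_le hr hv hv1 (remWork_mono hr hv hv1 he p _) h0 hmem)

/-- **Theorem 2: Limited Gang FJP schedulers are predictable on identical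
platforms.** Let `Jminus`, `J`, `Jplus` be the ordered job sets (0-indexed,
decreasing priorities, identical release times, processor requirements and
deadlines) with execution times `eᵢ⁻ ≤ eᵢ ≤ eᵢ⁺` respectively. For every `i` such
that `J⁺⁽ⁱ⁺¹⁾ = {J₀⁺, …, Jᵢ⁺}` is schedulable by the Limited Gang FJP scheduler
on `m` identical processors: `S(J⁻⁽ⁱ⁺¹⁾) ≤ S(J⁽ⁱ⁺¹⁾) ≤ S(J⁺⁽ⁱ⁺¹⁾)` and
`F(J⁻⁽ⁱ⁺¹⁾) ≤ F(J⁽ⁱ⁺¹⁾) ≤ F(J⁺⁽ⁱ⁺¹⁾)`. -/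
theorem limited_gang_fjp_predictable
    (m : ℕ) (Jminus J Jplus : ℕ → Job)
    (hr : ∀ i, (Jminus i).r = (J i).r ∧ (Jplus i).r = (J i).r)
    (hv : ∀ i, (Jminus i).v = (J i).v ∧ (Jplus i).v = (J i).v)
    (hd : ∀ i, (Jminus i).d = (J i).d ∧ (Jplus i).d = (J i).d)
    (he : ∀ i, (Jminus i).e ≤ (J i).e ∧ (J i).e ≤ (Jplus i).e)
    (hv1 : ∀ i, 1 ≤ (J i).v) :
    ∀ i, Schedulable m Jplus true (i + 1) →
      (startTime m Jminus true (i + 1) i ≤ startTime m J true (i + 1) i ∧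
       startTime m J true (i + 1) i ≤ startTime m Jplus true (i + 1) i) ∧
      (finishTime m Jminus true (i + 1) i ≤ finishTime m J true (i + 1) i ∧
       finishTime m J true (i + 1) i ≤ finishTime m Jplus true (i + 1) i) := by
  intro i hsched
  have hfin' := hsched i i.lt_succ_self
  have hrJ : ∀ i, (J i).r = (Jplus i).r := fun i => (hr i).2.symm
  have hvJ : ∀ i, (J i).v = (Jplus i).v := fun i => (hv i).2.symm
  have heJ : ∀ i, (J i).e ≤ (Jplus i).e := fun i => (he i).2
  have hv1J : ∀ i, 1 ≤ (Jplus i).v := fun i => hvJ i ▸ hv1 i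
  have hfin : remWork m J true (i + 1) (Jplus i).d i = 0 :=
    Nat.le_zero.1 (hfin' ▸ remWork_mono hrJ hvJ hv1J heJ (i + 1) _ i)
  have hrm : ∀ i, (Jminus i).r = (J i).r := fun i => (hr i).1
  have hvm : ∀ i, (Jminus i).v = (J i).v := fun i => (hv i).1
  have hem : ∀ i, (Jminus i).e ≤ (J i).e := fun i => (he i).1
  exact ⟨⟨startTime_mono hrm hvm hv1 hem hfin, startTime_mono hrJ hvJ hv1J heJ hfin'⟩,
    finishTime_mono hrm hvm hv1 hem hfin, finishTime_mono hrJ hvJ hv1J heJ hfin'⟩
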